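/- arXiv:1810.08466 — 3 statements merged into one kernel-verified Lean document; each statement's English description precedes it below -/
import Mathlib

section
/- Let (Ω, 𝓕, μ) be a probability space, T > 0, x > 0 and y > 0. Let H : [0,T] × Ω → (0,∞) and H_T : Ω → (0,∞) be measurable. Let U₁, U₂ : (0,∞) → ℝ be concave and differentiable and let I₁, I₂ : (0,∞) → (0,∞) satisfy U₁'(I₁(z)) = z and U₂'(I₂(z)) = z for all z > 0. Define γ̂_t := I₁(y·H_t) and V̂ := I₂(y·H_T), and assume E[∫₀ᵀ H_t·γ̂_t dt + H_T·V̂] = x, with U₁(γ̂), U₂(V̂) integrable. Then (γ̂, V̂) is optimal: for every measurable pair γ : [0,T] × Ω → (0,∞), V : Ω → (0,∞) with U₁(γ), U₂(V), H·γ and H_T·V integrable and satisfying E[∫₀ᵀ H_t γ_t dt + H_T·V] ≤ x, one has E[∫₀ᵀ U₁(γ_t) dt + U₂(V)] ≤ E[∫₀ᵀ U₁(γ̂_t) dt + U₂(V̂)]. -/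
open MeasureTheory

/-- A concave function lies below its tangent lines. -/
lemma ConcaveOn.le_add_mul_sub_of_hasDerivAt {S : Set ℝ} {f : ℝ → ℝ} {f' a b : ℝ}
    (hf : ConcaveOn ℝ S f) (ha : a ∈ S) (hb : b ∈ S) (hd : HasDerivAt f f' a) :
    f b ≤ f a + f' * (b - a) := by
  rcases lt_trichotomy a b with hab | rfl | hab
  · have h := hf.slope_le_of_hasDerivAt ha hb hab hd
    rw [slope_def_field, div_le_iff₀ (sub_pos.2 hab)] at h
    linarith
  · simp
  · have h := hf.le_slope_of_hasDerivAt hb ha hab hd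
    rw [slope_def_field, le_div_iff₀ (sub_pos.2 hab)] at h
    linarith

/-- An inverse `I` of the marginal utility `U'` solves the dual problem: `I (y * h)` maximizes
`U c - y * h * c` over `c > 0`. -/
lemma ConcaveOn.le_add_of_deriv_inverse {U U' I : ℝ → ℝ}
    (hU : ConcaveOn ℝ (Set.Ioi 0) U) (hU' : ∀ z ∈ Set.Ioi (0 : ℝ), HasDerivAt U (U' z) z)
    (hIpos : ∀ z > (0 : ℝ), 0 < I z) (hI : ∀ z > (0 : ℝ), U' (I z) = z)
    {y h c : ℝ} (hy : 0 < y) (hh : 0 < h) (hc : 0 < c) :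
    U c ≤ U (I (y * h)) + y * (h * c - h * I (y * h)) := by
  have hz : 0 < y * h := mul_pos hy hh
  have key := hU.le_add_mul_sub_of_hasDerivAt (hIpos _ hz) hc (hU' _ (hIpos _ hz))
  rw [hI _ hz] at key
  linarith

namespace MeasureTheory

lemma integral_le_add_mul_sub_integral {α : Type*} [MeasurableSpace α] {ν : Measure α}
    {u v g h : α → ℝ} (y : ℝ) (hu : Integrable u ν) (hv : Integrable v ν)
    (hg : Integrable g ν) (hh : Integrable h ν)
    (hle : ∀ᵐ a ∂ν, u a ≤ v a + y * (g a - h a)) :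
    ∫ a, u a ∂ν ≤ ∫ a, v a ∂ν + y * (∫ a, g a ∂ν - ∫ a, h a ∂ν) := by
  have hgh : Integrable (fun a => y * (g a - h a)) ν := (hg.sub hh).const_mul y
  rw [← integral_sub hg hh, ← integral_const_mul, ← integral_add hv hgh]
  exact integral_mono_ae hu (hv.add hgh) hle

/-- Fubini's theorem for a running term plus a terminal term. -/
lemma integral_integral_add_right {α β : Type*} [MeasurableSpace α] [MeasurableSpace β]
    {ν : Measure α} {μ : Measure β} [SFinite ν] [SFinite μ] {f : α × β → ℝ} {g : β → ℝ}
    (hf : Integrable f (ν.prod μ)) (hg : Integrable g μ) :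
    ∫ b, ((∫ a, f (a, b) ∂ν) + g b) ∂μ = ∫ p, f p ∂(ν.prod μ) + ∫ b, g b ∂μ := by
  rw [integral_add hf.integral_prod_right hg, integral_prod_symm f hf]

end MeasureTheory

/-- Verification step of the martingale method: the candidate consumption /
terminal wealth pair `γ̂_t = I₁(y H_t)`, `V̂ = I₂(y H_T)`, built from the inverse
marginal utilities evaluated at a positive state-price density `H`, and which
saturates the budget constraint `E[∫₀ᵀ H_t γ̂_t dt + H_T V̂] = x`, dominates
every budget-feasible pair `(γ, V)` in expected utility. -/
theorem martingale_method_verification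
    {Ω : Type*} [MeasurableSpace Ω] (μ : Measure Ω) [IsProbabilityMeasure μ]
    (T x y : ℝ) (hT : 0 < T) (hx : 0 < x) (hy : 0 < y)
    (H : ℝ → Ω → ℝ) (HT : Ω → ℝ)
    (hHmeas : Measurable (Function.uncurry H)) (hHTmeas : Measurable HT)
    (hHpos : ∀ t ∈ Set.Icc (0 : ℝ) T, ∀ ω, 0 < H t ω)
    (hHTpos : ∀ ω, 0 < HT ω)
    (U₁ U₁' U₂ U₂' I₁ I₂ : ℝ → ℝ)
    (hU₁conc : ConcaveOn ℝ (Set.Ioi (0 : ℝ)) U₁)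
    (hU₂conc : ConcaveOn ℝ (Set.Ioi (0 : ℝ)) U₂)
    (hU₁deriv : ∀ z ∈ Set.Ioi (0 : ℝ), HasDerivAt U₁ (U₁' z) z)
    (hU₂deriv : ∀ z ∈ Set.Ioi (0 : ℝ), HasDerivAt U₂ (U₂' z) z)
    (hI₁pos : ∀ z > (0 : ℝ), 0 < I₁ z) (hI₂pos : ∀ z > (0 : ℝ), 0 < I₂ z)
    (hI₁ : ∀ z > (0 : ℝ), U₁' (I₁ z) = z) (hI₂ : ∀ z > (0 : ℝ), U₂' (I₂ z) = z)
    -- the candidate pair : γ̂ t ω = I₁ (y * H t ω), V̂ ω = I₂ (y * HT ω)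
    (γhat : ℝ → Ω → ℝ) (Vhat : Ω → ℝ)
    (hγhat : ∀ t ω, γhat t ω = I₁ (y * H t ω))
    (hVhat : ∀ ω, Vhat ω = I₂ (y * HT ω))
    -- saturated budget constraint and integrability for the candidate
    (hsat :
      (∫ ω, ((∫ t in Set.Icc (0 : ℝ) T, H t ω * γhat t ω) + HT ω * Vhat ω) ∂μ)
        = x)
    (hinthγhat : Integrable (fun p : ℝ × Ω => H p.1 p.2 * γhat p.1 p.2)
      (((volume : Measure ℝ).restrict (Set.Icc 0 T)).prod μ))
    (hintUγhat : Integrable (fun p : ℝ × Ω => U₁ (γhat p.1 p.2))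
      (((volume : Measure ℝ).restrict (Set.Icc 0 T)).prod μ))
    (hintHTVhat : Integrable (fun ω => HT ω * Vhat ω) μ)
    (hintUVhat : Integrable (fun ω => U₂ (Vhat ω)) μ) :
    -- optimality: every budget-feasible pair is dominated
    ∀ (γ : ℝ → Ω → ℝ) (V : Ω → ℝ),
      Measurable (Function.uncurry γ) → Measurable V →
      (∀ t ∈ Set.Icc (0 : ℝ) T, ∀ ω, 0 < γ t ω) → (∀ ω, 0 < V ω) →
      Integrable (fun p : ℝ × Ω => U₁ (γ p.1 p.2))
        (((volume : Measure ℝ).restrict (Set.Icc 0 T)).prod μ) →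
      Integrable (fun ω => U₂ (V ω)) μ →
      Integrable (fun p : ℝ × Ω => H p.1 p.2 * γ p.1 p.2)
        (((volume : Measure ℝ).restrict (Set.Icc 0 T)).prod μ) →
      Integrable (fun ω => HT ω * V ω) μ →
      (∫ ω, ((∫ t in Set.Icc (0 : ℝ) T, H t ω * γ t ω) + HT ω * V ω) ∂μ) ≤ x →
      (∫ ω, ((∫ t in Set.Icc (0 : ℝ) T, U₁ (γ t ω)) + U₂ (V ω)) ∂μ) ≤
        (∫ ω, ((∫ t in Set.Icc (0 : ℝ) T, U₁ (γhat t ω)) + U₂ (Vhat ω)) ∂μ) := by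
  intro γ V _ _ hγpos hVpos hUγ hUV hHγ hHV hbudget
  have hrun := integral_le_add_mul_sub_integral y hUγ hintUγhat hHγ hinthγhat <| by
    filter_upwards [Measure.quasiMeasurePreserving_fst.ae (ae_restrict_mem measurableSet_Icc)]
      with p hp
    rw [hγhat]
    exact hU₁conc.le_add_of_deriv_inverse hU₁deriv hI₁pos hI₁ hy (hHpos _ hp _) (hγpos _ hp _)
  have hterm := integral_le_add_mul_sub_integral y hUV hintUVhat hHV hintHTVhat <|
    Filter.Eventually.of_forall fun ω => by
      rw [hVhat]
      exact hU₂conc.le_add_of_deriv_inverse hU₂deriv hI₂pos hI₂ hy (hHTpos ω) (hVpos ω)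
  rw [integral_integral_add_right hinthγhat hintHTVhat] at hsat
  rw [integral_integral_add_right hHγ hHV, ← hsat] at hbudget
  rw [integral_integral_add_right hUγ hUV, integral_integral_add_right hintUγhat hintUVhat]
  linarith [mul_le_mul_of_nonneg_left hbudget hy.le]
end

section
/- Let (Ω, 𝓕, μ) be a probability space, T > 0, x > 0 and η > 0 with η ≠ 1. Let H : [0,T] × Ω → (0,∞) and H_T : Ω → (0,∞) be measurable with 𝒳(1) := E[∫₀ᵀ H_t^{1−1/η} dt + H_T^{1−1/η}] finite and positive. Define γ̂_t := (x/𝒳(1))·H_t^{−1/η} and V̂ := (x/𝒳(1))·H_T^{−1/η}. Then for every measurable pair γ : [0,T] × Ω → (0,∞), V : Ω → (0,∞) with γ^{1−η}, V^{1−η}, H·γ and H_T·V integrable and satisfying the budget constraint E[∫₀ᵀ H_t γ_t dt + H_T·V] ≤ x, one has E[∫₀ᵀ γ_t^{1−η}/(1−η) dt + V^{1−η}/(1−η)] ≤ E[∫₀ᵀ γ̂_t^{1−η}/(1−η) dt + V̂^{1−η}/(1−η)]. -/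
open MeasureTheory

/-- The tangent-line inequality for the CRRA utility `x ↦ x ^ (1 - η) / (1 - η)`. -/
theorem crra_le_tangent {η a b : ℝ} (hη : 0 < η) (hη1 : η ≠ 1) (ha : 0 < a) (hb : 0 < b) :
    a ^ (1 - η) / (1 - η) ≤ b ^ (1 - η) / (1 - η) + b ^ (-η) * (a - b) := by
  have key : (a / b) ^ (1 - η) / (1 - η) ≤ 1 / (1 - η) + (a / b - 1) := by
    have hs : 0 < a / b := div_pos ha hb
    generalize a / b = s at hs
    rcases lt_or_gt_of_ne hη1 with h | h
    · have h1 := rpow_one_add_le_one_add_mul_self (s := s - 1) (by linarith)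
        (p := 1 - η) (by linarith) (by linarith)
      rw [add_sub_cancel] at h1
      have hp : 0 < 1 - η := by linarith
      rw [div_le_iff₀ hp]
      field_simp
      linarith
    · have h1 := Real.geom_mean_le_arith_mean2_weighted (w₁ := 1 / η) (w₂ := (η - 1) / η)
        (p₁ := s ^ (1 - η)) (p₂ := s) (by positivity)
        (div_nonneg (by linarith) hη.le) (by positivity) hs.le (by field_simp; ring)
      rw [← Real.rpow_mul hs.le, ← Real.rpow_add hs,
        show (1 - η) * (1 / η) + (η - 1) / η = 0 by field_simp; ring, Real.rpow_zero] at h1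
      have h2 : η ≤ s ^ (1 - η) + (η - 1) * s := by
        have h3 := mul_le_mul_of_nonneg_left h1 hη.le
        have h4 : η * (1 / η * s ^ (1 - η) + (η - 1) / η * s) = s ^ (1 - η) + (η - 1) * s := by
          field_simp
        linarith
      have hp : 1 - η < 0 := by linarith
      rw [div_le_iff_of_neg hp, add_mul, one_div, inv_mul_cancel₀ hp.ne]
      linarith
  have hb' : 0 < b ^ (1 - η) := Real.rpow_pos_of_pos hb _
  have hbη : b ^ (1 - η) = b ^ (-η) * b := by
    rw [sub_eq_neg_add, Real.rpow_add_one hb.ne']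
  calc a ^ (1 - η) / (1 - η) = b ^ (1 - η) * ((a / b) ^ (1 - η) / (1 - η)) := by
        rw [Real.div_rpow ha.le hb.le]
        field_simp
    _ ≤ b ^ (1 - η) * (1 / (1 - η) + (a / b - 1)) := mul_le_mul_of_nonneg_left key hb'.le
    _ = b ^ (1 - η) / (1 - η) + b ^ (1 - η) * (a / b - 1) := by ring
    _ = b ^ (1 - η) / (1 - η) + b ^ (-η) * (a - b) := by
        congr 1
        rw [hbη]
        field_simp

/-- The utility of `c * h ^ (-(1 / η))` is a multiple of `h ^ (1 - 1 / η)`. -/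
theorem crra_candidate_rpow {η c h : ℝ} (hη : 0 < η) (hc : 0 < c) (hh : 0 < h) :
    (c * h ^ (-(1 / η))) ^ (1 - η) = c ^ (1 - η) * h ^ (1 - 1 / η) := by
  rw [Real.mul_rpow hc.le (Real.rpow_nonneg hh.le _), ← Real.rpow_mul hh.le]
  congr 2
  field_simp
  ring

/-- The tangent-line inequality at `c * h ^ (-(1 / η))`, where the marginal utility is
`c ^ (-η) * h`. -/
theorem crra_le_candidate {η c h g : ℝ} (hη : 0 < η) (hη1 : η ≠ 1) (hc : 0 < c)
    (hh : 0 < h) (hg : 0 < g) :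
    g ^ (1 - η) / (1 - η) ≤ (c ^ (1 - η) / (1 - η) - c ^ (-η) * c) * h ^ (1 - 1 / η)
      + c ^ (-η) * (h * g) := by
  have h1 := crra_le_tangent hη hη1 hg (mul_pos hc (Real.rpow_pos_of_pos hh (-(1 / η))))
  have h2 : (c * h ^ (-(1 / η))) ^ (-η) = c ^ (-η) * h := by
    rw [Real.mul_rpow hc.le (Real.rpow_nonneg hh.le _), ← Real.rpow_mul hh.le,
      show -(1 / η) * -η = 1 by field_simp, Real.rpow_one]
  have h3 : h ^ (1 - 1 / η) = h * h ^ (-(1 / η)) := by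
    rw [sub_eq_add_neg, Real.rpow_add hh, Real.rpow_one]
  rw [crra_candidate_rpow hη hc hh, h2] at h1
  refine h1.trans_eq ?_
  rw [h3]
  ring

/-- An iterated integral plus a terminal integral, as a sum of integrals. -/
theorem integral_integral_add_eq {α Ω : Type*} [MeasurableSpace α] [MeasurableSpace Ω]
    {ν : Measure α} {μ : Measure Ω} [SFinite ν] [SFinite μ] {f : α → Ω → ℝ} {g : Ω → ℝ}
    (hf : Integrable (fun p : α × Ω => f p.1 p.2) (ν.prod μ)) (hg : Integrable g μ) :
    ∫ ω, ((∫ t, f t ω ∂ν) + g ω) ∂μ = ∫ p, f p.1 p.2 ∂(ν.prod μ) + ∫ ω, g ω ∂μ := by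
  rw [integral_add hf.integral_prod_right hg, integral_prod_symm _ hf]

/-- Explicit verification of optimality for CRRA preferences
`U(x) = x^(1-η)/(1-η)` (`η > 0`, `η ≠ 1`): the candidate
`γ̂_t = (x/𝒳(1)) H_t^(-1/η)`, `V̂ = (x/𝒳(1)) H_T^(-1/η)` with
`𝒳(1) = E[∫₀ᵀ H_t^(1-1/η) dt + H_T^(1-1/η)]` finite and positive dominates every
measurable positive pair `(γ, V)` satisfying the budget constraint
`E[∫₀ᵀ H_t γ_t dt + H_T V] ≤ x`. -/
theorem crra_verification_optimality
    {Ω : Type*} [MeasurableSpace Ω] (μ : Measure Ω) [IsProbabilityMeasure μ]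
    (T x η : ℝ) (hT : 0 < T) (hx : 0 < x) (hη : 0 < η) (hη1 : η ≠ 1)
    (H : ℝ → Ω → ℝ) (HT : Ω → ℝ)
    (hHmeas : Measurable (Function.uncurry H)) (hHTmeas : Measurable HT)
    (hHpos : ∀ t ∈ Set.Icc (0 : ℝ) T, ∀ ω, 0 < H t ω)
    (hHTpos : ∀ ω, 0 < HT ω)
    (X1 : ℝ)
    (hX1 : X1 =
      ∫ ω, ((∫ t in Set.Icc (0 : ℝ) T, (H t ω) ^ (1 - 1 / η)) +
        (HT ω) ^ (1 - 1 / η)) ∂μ)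
    (hX1int : Integrable
      (fun ω => (∫ t in Set.Icc (0 : ℝ) T, (H t ω) ^ (1 - 1 / η)) +
        (HT ω) ^ (1 - 1 / η)) μ)
    (hX1int' : Integrable (fun p : ℝ × Ω => (H p.1 p.2) ^ (1 - 1 / η))
      (((volume : Measure ℝ).restrict (Set.Icc 0 T)).prod μ))
    (hX1pos : 0 < X1)
    -- the candidate pair
    (γhat : ℝ → Ω → ℝ) (Vhat : Ω → ℝ)
    (hγhat : ∀ t ω, γhat t ω = (x / X1) * (H t ω) ^ (-(1 / η)))
    (hVhat : ∀ ω, Vhat ω = (x / X1) * (HT ω) ^ (-(1 / η))) :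
    ∀ (γ : ℝ → Ω → ℝ) (V : Ω → ℝ),
      Measurable (Function.uncurry γ) → Measurable V →
      (∀ t ∈ Set.Icc (0 : ℝ) T, ∀ ω, 0 < γ t ω) → (∀ ω, 0 < V ω) →
      Integrable (fun p : ℝ × Ω => (γ p.1 p.2) ^ (1 - η))
        (((volume : Measure ℝ).restrict (Set.Icc 0 T)).prod μ) →
      Integrable (fun ω => (V ω) ^ (1 - η)) μ →
      Integrable (fun p : ℝ × Ω => H p.1 p.2 * γ p.1 p.2)
        (((volume : Measure ℝ).restrict (Set.Icc 0 T)).prod μ) →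
      Integrable (fun ω => HT ω * V ω) μ →
      (∫ ω, ((∫ t in Set.Icc (0 : ℝ) T, H t ω * γ t ω) + HT ω * V ω) ∂μ) ≤ x →
      (∫ ω, ((∫ t in Set.Icc (0 : ℝ) T, (γ t ω) ^ (1 - η) / (1 - η)) +
          (V ω) ^ (1 - η) / (1 - η)) ∂μ) ≤
        (∫ ω, ((∫ t in Set.Icc (0 : ℝ) T, (γhat t ω) ^ (1 - η) / (1 - η)) +
          (Vhat ω) ^ (1 - η) / (1 - η)) ∂μ) := by
  intro γ V _ _ hγ hV hγi hVi hHγ hHV hbud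
  have hc : 0 < x / X1 := div_pos hx hX1pos
  have hcX : x / X1 * X1 = x := div_mul_cancel₀ x hX1pos.ne'
  have hmem : ∀ᵐ p ∂(((volume : Measure ℝ).restrict (Set.Icc 0 T)).prod μ),
      p.1 ∈ Set.Icc (0 : ℝ) T :=
    Measure.quasiMeasurePreserving_fst.ae (ae_restrict_mem measurableSet_Icc)
  have hHTi : Integrable (fun ω => (HT ω) ^ (1 - 1 / η)) μ := by
    refine (hX1int.sub hX1int'.integral_prod_right).congr (.of_forall fun ω => ?_)
    simp
  have hγhat_ae : (fun p : ℝ × Ω => (x / X1) ^ (1 - η) / (1 - η) * H p.1 p.2 ^ (1 - 1 / η))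
      =ᵐ[((volume : Measure ℝ).restrict (Set.Icc 0 T)).prod μ]
      fun p => γhat p.1 p.2 ^ (1 - η) / (1 - η) := by
    filter_upwards [hmem] with p hp
    rw [hγhat, crra_candidate_rpow hη hc (hHpos _ hp _)]
    ring
  have hVhat_eq : (fun ω => Vhat ω ^ (1 - η) / (1 - η)) =
      fun ω => (x / X1) ^ (1 - η) / (1 - η) * HT ω ^ (1 - 1 / η) := by
    ext ω
    rw [hVhat, crra_candidate_rpow hη hc (hHTpos _)]
    ring
  have hVhat_int : Integrable (fun ω => Vhat ω ^ (1 - η) / (1 - η)) μ :=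
    hVhat_eq ▸ hHTi.const_mul _
  rw [integral_integral_add_eq hX1int' hHTi] at hX1
  rw [integral_integral_add_eq hHγ hHV] at hbud
  rw [integral_integral_add_eq (hγi.div_const _) (hVi.div_const _),
    integral_integral_add_eq ((hX1int'.const_mul _).congr hγhat_ae) hVhat_int,
    ← integral_congr_ae hγhat_ae, hVhat_eq, integral_const_mul, integral_const_mul]
  have hγ_le := integral_mono_ae (hγi.div_const (1 - η))
    ((hX1int'.const_mul ((x / X1) ^ (1 - η) / (1 - η) - (x / X1) ^ (-η) * (x / X1))).add
      (hHγ.const_mul ((x / X1) ^ (-η))))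
    (by
      filter_upwards [hmem] with p hp
      exact crra_le_candidate hη hη1 hc (hHpos _ hp _) (hγ _ hp _))
  have hV_le := integral_mono (hVi.div_const (1 - η))
    ((hHTi.const_mul ((x / X1) ^ (1 - η) / (1 - η) - (x / X1) ^ (-η) * (x / X1))).add
      (hHV.const_mul ((x / X1) ^ (-η))))
    (fun ω => crra_le_candidate hη hη1 hc (hHTpos ω) (hV ω))
  rw [integral_add' (hX1int'.const_mul _) (hHγ.const_mul _), integral_const_mul,
    integral_const_mul] at hγ_le
  rw [integral_add' (hHTi.const_mul _) (hHV.const_mul _), integral_const_mul,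
    integral_const_mul] at hV_le
  have hbud' := mul_le_mul_of_nonneg_left hbud (Real.rpow_nonneg hc.le (-η))
  have hcX' : (x / X1) ^ (-η) * (x / X1) * X1 = (x / X1) ^ (-η) * x := by
    rw [mul_assoc, hcX]
  rw [← hcX'] at hbud'
  generalize (x / X1) ^ (-η) * (x / X1) = d at hγ_le hV_le hbud'
  have hdX := congrArg (d * ·) hX1
  simp only [mul_add] at hdX hbud'
  linarith
end

section
/- If λ > 0 and F({c}) > 0, then h(κ) tends to −∞ as κ tends to 1/c from the left. -/
open MeasureTheory Filter

/-- If `F` is carried by `[0, c]` and `κ ∈ [0, 1/c)`, then `y * (1 - κ * y) ^ (-η)` is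
`F`-integrable. -/
lemma integrable_mul_one_sub_mul_rpow_neg {c η κ : ℝ} (hη : 0 ≤ η)
    {F : Measure ℝ} [IsFiniteMeasure F] (hF : ∀ᵐ y ∂F, y ∈ Set.Icc 0 c)
    (hκ : 0 ≤ κ) (hκc : κ * c < 1) :
    Integrable (fun y => y * (1 - κ * y) ^ (-η)) F := by
  refine Integrable.of_bound (Measurable.aestronglyMeasurable (by fun_prop))
    (c * (1 - κ * c) ^ (-η)) ?_
  filter_upwards [hF] with y hy
  have hle : κ * y ≤ κ * c := mul_le_mul_of_nonneg_left hy.2 hκ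
  have hpos : 0 ≤ (1 - κ * y) ^ (-η) := Real.rpow_nonneg (by linarith) _
  rw [Real.norm_of_nonneg (mul_nonneg hy.1 hpos)]
  exact mul_le_mul hy.2
    (Real.rpow_le_rpow_of_nonpos (by linarith) (by linarith) (by linarith))
    hpos (hy.1.trans hy.2)

/-- The contribution of the atom at `c` bounds the integral from below. -/
lemma measureReal_singleton_mul_le_integral {c η κ : ℝ} (hη : 0 ≤ η)
    {F : Measure ℝ} [IsFiniteMeasure F] (hF : ∀ᵐ y ∂F, y ∈ Set.Icc 0 c)
    (hκ : 0 ≤ κ) (hκc : κ * c < 1) :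
    F.real {c} * (c * (1 - κ * c) ^ (-η)) ≤ ∫ y, y * (1 - κ * y) ^ (-η) ∂F := by
  have hnonneg : 0 ≤ᵐ[F] fun y => y * (1 - κ * y) ^ (-η) := by
    filter_upwards [hF] with y hy
    have hle : κ * y ≤ κ * c := mul_le_mul_of_nonneg_left hy.2 hκ
    exact mul_nonneg hy.1 (Real.rpow_nonneg (by linarith) _)
  simpa [integral_singleton, measureReal_def] using setIntegral_le_integral (s := {c})
    (integrable_mul_one_sub_mul_rpow_neg hη hF hκ hκc) hnonneg

/-- If `F` is carried by `[0, c]` and has an atom at `c`, then the integral of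
`y * (1 - κ * y) ^ (-η)` explodes as `κ` increases to `1/c`. -/
lemma tendsto_integral_mul_one_sub_mul_rpow_neg_atTop {c η : ℝ} (hc : 0 < c) (hη : 0 < η)
    {F : Measure ℝ} [IsFiniteMeasure F] (hF : ∀ᵐ y ∂F, y ∈ Set.Icc 0 c)
    (hatom : 0 < F {c}) :
    Tendsto (fun κ : ℝ => ∫ y, y * (1 - κ * y) ^ (-η) ∂F)
      (nhdsWithin (1 / c) (Set.Iio (1 / c))) atTop := by
  have hgap : Tendsto (fun κ : ℝ => 1 - κ * c) (nhdsWithin (1 / c) (Set.Iio (1 / c)))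
      (nhdsWithin 0 (Set.Ioi 0)) := by
    refine tendsto_nhdsWithin_iff.2 ⟨?_, ?_⟩
    · have hcont : Continuous fun κ : ℝ => 1 - κ * c := by fun_prop
      simpa [hc.ne'] using (hcont.tendsto (1 / c)).mono_left nhdsWithin_le_nhds
    · filter_upwards [self_mem_nhdsWithin] with κ hκ
      exact sub_pos.2 ((lt_div_iff₀ hc).1 hκ)
  have hatom_real : 0 < F.real {c} := ENNReal.toReal_pos hatom.ne' (measure_ne_top _ _)
  refine tendsto_atTop_mono' _ ?_ (((tendsto_rpow_neg_nhdsGT_zero (neg_lt_zero.2 hη)).comp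
    hgap).const_mul_atTop hc |>.const_mul_atTop hatom_real)
  filter_upwards [self_mem_nhdsWithin,
    nhdsWithin_le_nhds (lt_mem_nhds (one_div_pos.2 hc))] with κ hκ hκ0
  exact measureReal_singleton_mul_le_integral hη.le hF hκ0.le ((lt_div_iff₀ hc).1 hκ)

/-- If `λ > 0` and the claim distribution `F` (a Borel probability measure
supported in `[0, c]`) has an atom at the policy limit `c`, then the optimality
function `h(κ) = p − a + b(ρ(μ−r)/σ − (1−ρ²)ηbκ) − λ ∫ y (1−κy)^(−η) dF(y)`
tends to `−∞` as `κ → (1/c)⁻`. -/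
theorem h_tendsto_atBot
    (p a b m r lam σ ρ c η : ℝ) (hσ : σ ≠ 0) (hlam : 0 < lam)
    (hρ₁ : -1 ≤ ρ) (hρ₂ : ρ ≤ 1) (hc : 0 < c) (hη : 0 < η)
    (F : Measure ℝ) [IsProbabilityMeasure F]
    (hsupp : F (Set.Icc 0 c)ᶜ = 0)
    (hatom : 0 < F {c}) :
    Tendsto
      (fun κ : ℝ => p - a + b * (ρ * (m - r) / σ - (1 - ρ ^ 2) * η * b * κ) -
        lam * ∫ y, y * (1 - κ * y) ^ (-η) ∂F)
      (nhdsWithin (1 / c) (Set.Iio (1 / c))) atBot := by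
  have hlin : Continuous fun κ : ℝ =>
      p - a + b * (ρ * (m - r) / σ - (1 - ρ ^ 2) * η * b * κ) := by fun_prop
  simp only [sub_eq_add_neg _ (lam * _)]
  exact ((hlin.tendsto (1 / c)).mono_left nhdsWithin_le_nhds).add_atBot
    (tendsto_neg_atTop_atBot.comp ((tendsto_integral_mul_one_sub_mul_rpow_neg_atTop hc hη
      (mem_ae_iff.2 hsupp) hatom).const_mul_atTop hlam))
end
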